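/- Let S be a nonempty finite set and let Λ_1, …, Λ_m ∈ ℕ^S be finitely many vectors such that each Λ_i has coordinate sum |Λ_i| ≥ 2 and every coordinate Λ_{i,ρ} ≤ 2. Let μ_loc and μ be the associated local and global Möbius functions and Π(d) = Π_{ρ∈S} d_ρ. Then for every real number s > 1/2: (i) the family ( |μ(d)| · Π(d)^{−s} ) indexed by d ∈ (ℕ_{>0})^S is summable; (ii) the product over all primes p of the (finite) sums Σ_{λ ∈ ℕ^S} |μ_loc(λ)| p^{−s|λ|} is absolutely convergent; and (iii) Σ_{d ∈ (ℕ_{>0})^S} |μ(d)| · Π(d)^{−s} = Π_p ( Σ_{λ ∈ ℕ^S} |μ_loc(λ)| p^{−s|λ|} ). -/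

import Mathlib

/-- The global Möbius function `μ(d) = Π_p μloc((v_p(d_ρ))_ρ)`, a product over all primes
with only finitely many factors different from `1`. -/
noncomputable def muGlob {S : Type*} (μloc : (S → ℕ) → ℤ) (d : S → ℕ) : ℤ :=
  ∏ᶠ (p : ℕ) (_ : p.Prime), μloc fun ρ => (d ρ).factorization p

section LocalMoebius

variable {S : Type*} [Fintype S] [DecidableEq S] {m : ℕ} {Λ : Fin m → S → ℕ}
  {μloc : (S → ℕ) → ℤ}

theorem muLoc_zero (hsum : ∀ i, 2 ≤ ∑ ρ, Λ i ρ)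
    (hμ : ∀ τ : S → ℕ,
      (if ∀ i, ∃ ρ, τ ρ < Λ i ρ then (1 : ℤ) else 0) = ∑ l ∈ Finset.Iic τ, μloc l) :
    μloc 0 = 1 := by
  have h := hμ 0
  have hIic : Finset.Iic (0 : S → ℕ) = {0} := by
    ext l
    simp
  rw [hIic, Finset.sum_singleton, if_pos] at h
  · exact h.symm
  · intro i
    by_contra! hcon
    have := Finset.sum_le_sum fun ρ (_ : ρ ∈ Finset.univ) => hcon ρ
    simp only [Pi.zero_apply, Finset.sum_const_zero] at this
    have := hsum i
    omega

theorem muLoc_eq_zero_of_sum_eq_one (hsum : ∀ i, 2 ≤ ∑ ρ, Λ i ρ)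
    (hμ : ∀ τ : S → ℕ,
      (if ∀ i, ∃ ρ, τ ρ < Λ i ρ then (1 : ℤ) else 0) = ∑ l ∈ Finset.Iic τ, μloc l)
    {τ : S → ℕ} (hτ : ∑ ρ, τ ρ = 1) : μloc τ = 0 := by
  have h := hμ τ
  have hne : (0 : S → ℕ) ≠ τ := by
    rintro rfl
    simp at hτ
  have hIic : Finset.Iic τ = {0, τ} := by
    ext l
    simp only [Finset.mem_Iic, Finset.mem_insert, Finset.mem_singleton]
    refine ⟨fun hl => ?_, ?_⟩
    · by_cases h0 : ∑ ρ, l ρ = 0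
      · left
        ext ρ
        exact (Finset.sum_eq_zero_iff.1 h0) ρ (Finset.mem_univ _)
      · right
        have hle : ∑ ρ, l ρ ≤ ∑ ρ, τ ρ := Finset.sum_le_sum fun ρ _ => hl ρ
        have heq : ∑ ρ, l ρ = ∑ ρ, τ ρ := by omega
        ext ρ
        exact (Finset.sum_eq_sum_iff_of_le fun ρ _ => hl ρ).1 heq ρ (Finset.mem_univ _)
    · rintro (rfl | rfl)
      · exact fun ρ => Nat.zero_le _
      · exact le_rfl
  rw [hIic, Finset.sum_pair hne, muLoc_zero hsum hμ, if_pos] at h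
  · omega
  · intro i
    by_contra! hcon
    have := Finset.sum_le_sum fun ρ (_ : ρ ∈ Finset.univ) => hcon ρ
    have := hsum i
    omega

theorem muLoc_eq_zero_of_two_lt (hle : ∀ i ρ, Λ i ρ ≤ 2)
    (hμ : ∀ τ : S → ℕ,
      (if ∀ i, ∃ ρ, τ ρ < Λ i ρ then (1 : ℤ) else 0) = ∑ l ∈ Finset.Iic τ, μloc l)
    {σ : S} (τ : S → ℕ) (hτ : 2 < τ σ) : μloc τ = 0 := by
  induction τ using WellFoundedLT.induction with
  | ind τ ih =>
    set τ' : S → ℕ := Function.update τ σ (τ σ - 1) with hτ'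
    have hle' : τ' ≤ τ := by
      intro ρ
      by_cases h : ρ = σ
      · subst h; simp [hτ']
      · simp [hτ', h]
    have hX : (∀ i, ∃ ρ, τ ρ < Λ i ρ) ↔ ∀ i, ∃ ρ, τ' ρ < Λ i ρ := by
      refine forall_congr' fun i => exists_congr fun ρ => ?_
      by_cases h : ρ = σ
      · subst h
        have := hle i ρ
        simp only [hτ', Function.update_self]
        omega
      · simp [hτ', h]
    have h1 := hμ τ
    have h2 := hμ τ'
    simp only [hX] at h1
    rw [h2, ← Finset.sum_sdiff (Finset.Iic_subset_Iic.2 hle'), right_eq_add,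
      Finset.sum_eq_single τ] at h1
    · exact h1
    · intro l hl hne
      simp only [Finset.mem_sdiff, Finset.mem_Iic] at hl
      refine ih l (lt_of_le_of_ne hl.1 hne) ?_
      by_contra hcon
      refine hl.2 fun ρ => ?_
      by_cases h : ρ = σ
      · subst h
        simp only [hτ', Function.update_self]
        omega
      · simpa [hτ', h] using hl.1 ρ
    · intro hcon
      exfalso
      refine hcon ?_
      simp only [Finset.mem_sdiff, Finset.mem_Iic, le_refl, true_and]
      intro h
      have := h σ
      simp only [hτ', Function.update_self] at this
      omega

end LocalMoebius

section EulerProduct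

variable {S : Type*} {μloc : (S → ℕ) → ℤ}

theorem muGlob_eq_prod (h0 : μloc 0 = 1) {d : S → ℕ} {P : Finset Nat.Primes}
    (hP : ∀ p : Nat.Primes, p ∉ P → ∀ ρ, (d ρ).factorization p = 0) :
    muGlob μloc d = ∏ p ∈ P, μloc fun ρ => (d ρ).factorization p := by
  have h : muGlob μloc d = ∏ᶠ p : Nat.Primes, μloc fun ρ => (d ρ).factorization p :=
    (finprod_subtype_eq_finprod_cond (f := fun p : ℕ => μloc fun ρ => (d ρ).factorization p)
      Nat.Prime).symm
  rw [h]
  refine finprod_eq_prod_of_mulSupport_subset _ fun p hp => ?_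
  by_contra hcon
  refine hp ?_
  rw [← h0]
  exact congrArg μloc (funext fun ρ => hP p hcon ρ)

/-- The tuple of positive integers with prescribed exponents at the primes of `P`. -/
def tupleOfExponents (P : Finset Nat.Primes) (φ : P → S → ℕ) :
    {d : S → ℕ // ∀ ρ, 0 < d ρ} :=
  ⟨fun ρ => ∏ p : P, (p.1 : ℕ) ^ φ p ρ,
    fun _ => Finset.prod_pos fun p _ => pow_pos p.1.2.pos _⟩

theorem factorization_tupleOfExponents (P : Finset Nat.Primes) (φ : P → S → ℕ)
    (q : Nat.Primes) (ρ : S) :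
    ((tupleOfExponents P φ).1 ρ).factorization q = if h : q ∈ P then φ ⟨q, h⟩ ρ else 0 := by
  have key : ∀ p : P, ((p.1 : ℕ) ^ φ p ρ).factorization q = if p.1 = q then φ p ρ else 0 := by
    intro p
    rw [p.1.2.factorization_pow, Finsupp.single_apply]
    exact if_congr Subtype.ext_iff.symm rfl rfl
  simp only [tupleOfExponents]
  rw [Nat.factorization_prod fun p _ => (pow_pos p.1.2.pos _).ne', Finsupp.finsetSum_apply]
  simp only [key]
  split_ifs with h
  · rw [Finset.sum_eq_single ⟨q, h⟩]
    · simp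
    · intro p _ hp
      rw [if_neg]
      rintro rfl
      exact hp rfl
    · simp
  · refine Finset.sum_eq_zero fun p _ => if_neg ?_
    rintro rfl
    exact h p.2

theorem tupleOfExponents_injective (P : Finset Nat.Primes) :
    Function.Injective (tupleOfExponents (S := S) P) := by
  intro φ ψ h
  ext p ρ
  have h1 := factorization_tupleOfExponents P φ p.1 ρ
  have h2 := factorization_tupleOfExponents P ψ p.1 ρ
  rw [h] at h1
  simpa using h1.symm.trans h2

theorem tupleOfExponents_factorization {P : Finset Nat.Primes}
    (d : {d : S → ℕ // ∀ ρ, 0 < d ρ})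
    (hP : ∀ p : Nat.Primes, p ∉ P → ∀ ρ, (d.1 ρ).factorization p = 0) :
    tupleOfExponents P (fun p ρ => (d.1 ρ).factorization p.1) = d := by
  ext ρ
  refine Nat.eq_of_factorization_eq ((tupleOfExponents P _).2 ρ).ne' (d.2 ρ).ne' fun q => ?_
  by_cases hq : q.Prime
  · rw [factorization_tupleOfExponents P _ ⟨q, hq⟩ ρ]
    split_ifs with h
    · rfl
    · exact (hP _ h ρ).symm
  · simp [Nat.factorization_eq_zero_of_not_prime _ hq]

variable [Fintype S]

theorem abs_muGlob_tupleOfExponents (h0 : μloc 0 = 1) (s : ℝ) (P : Finset Nat.Primes)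
    (φ : P → S → ℕ) :
    (|muGlob μloc (tupleOfExponents P φ).1| : ℝ) *
        ((∏ ρ, (tupleOfExponents P φ).1 ρ : ℕ) : ℝ) ^ (-s) =
      ∏ p : P, (|μloc (φ p)| : ℝ) * ((p.1 : ℕ) : ℝ) ^ (-(s * ((∑ ρ, φ p ρ : ℕ) : ℝ))) := by
  rw [Finset.prod_mul_distrib]
  congr 1
  · rw [muGlob_eq_prod h0 (P := P)]
    · rw [← Finset.prod_coe_sort, Int.cast_prod, Finset.abs_prod]
      refine Finset.prod_congr rfl fun p _ => ?_
      congr 3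
      ext ρ
      simp [factorization_tupleOfExponents]
    · intro p hp ρ
      simp [factorization_tupleOfExponents, hp]
  · have : ∏ ρ, (tupleOfExponents P φ).1 ρ = ∏ p : P, (p.1 : ℕ) ^ ∑ ρ, φ p ρ := by
      simp only [tupleOfExponents]
      rw [Finset.prod_comm]
      simp only [Finset.prod_pow_eq_pow_sum]
    rw [this, Nat.cast_prod, ← Real.finsetProd_rpow _ _ fun _ _ => Nat.cast_nonneg _]
    refine Finset.prod_congr rfl fun p _ => ?_
    rw [Nat.cast_pow, ← Real.rpow_natCast, ← Real.rpow_mul (Nat.cast_nonneg _)]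
    congr 1
    ring

/-- The Euler product of a sum over tuples, for a local function with finite support. -/
theorem hasSum_abs_muGlob [DecidableEq S] (h0 : μloc 0 = 1) (B : Finset (S → ℕ))
    (hB : ∀ l, μloc l ≠ 0 → l ∈ B) (s : ℝ)
    (hmul : Multipliable fun p : Nat.Primes =>
      ∑ l ∈ B, (|μloc l| : ℝ) * ((p : ℕ) : ℝ) ^ (-(s * ((∑ ρ, l ρ : ℕ) : ℝ)))) :
    HasSum (fun d : {d : S → ℕ // ∀ ρ, 0 < d ρ} =>
        (|muGlob μloc d.1| : ℝ) * ((∏ ρ, d.1 ρ : ℕ) : ℝ) ^ (-s))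
      (∏' p : Nat.Primes,
        ∑ l ∈ B, (|μloc l| : ℝ) * ((p : ℕ) : ℝ) ^ (-(s * ((∑ ρ, l ρ : ℕ) : ℝ)))) := by
  classical
  set E : Nat.Primes → ℝ := fun p =>
    ∑ l ∈ B, (|μloc l| : ℝ) * ((p : ℕ) : ℝ) ^ (-(s * ((∑ ρ, l ρ : ℕ) : ℝ))) with hE
  have hnn : ∀ d : {d : S → ℕ // ∀ ρ, 0 < d ρ},
      0 ≤ (|muGlob μloc d.1| : ℝ) * ((∏ ρ, d.1 ρ : ℕ) : ℝ) ^ (-s) := fun d => by positivity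
  have hE1 : ∀ p, 1 ≤ E p := by
    intro p
    refine le_trans (le_of_eq ?_) (Finset.single_le_sum (fun l _ => by positivity)
      (hB 0 (by simp [h0])))
    simp [h0]
  have hT : ∀ P : Finset Nat.Primes,
      ∑ d ∈ (Fintype.piFinset fun _ : P => B).image (tupleOfExponents P),
        (|muGlob μloc d.1| : ℝ) * ((∏ ρ, d.1 ρ : ℕ) : ℝ) ^ (-s) = ∏ p ∈ P, E p := by
    intro P
    rw [Finset.sum_image (tupleOfExponents_injective P).injOn, ← Finset.prod_coe_sort, hE,
      Finset.prod_univ_sum]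
    exact Finset.sum_congr rfl fun φ _ => abs_muGlob_tupleOfExponents h0 s P φ
  refine hasSum_of_isLUB_of_nonneg _ hnn ⟨?_, ?_⟩
  · rintro _ ⟨D, rfl⟩
    let P : Finset Nat.Primes :=
      (D.biUnion fun d => Finset.univ.biUnion fun ρ => (d.1 ρ).primeFactors).subtype Nat.Prime
    have hP : ∀ d ∈ D, ∀ p : Nat.Primes, p ∉ P → ∀ ρ, (d.1 ρ).factorization p = 0 := by
      intro d hd p hp ρ
      rw [← Finsupp.notMem_support_iff, Nat.support_factorization]
      contrapose! hp
      exact Finset.mem_subtype.2 (Finset.mem_biUnion.2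
        ⟨d, hd, Finset.mem_biUnion.2 ⟨ρ, Finset.mem_univ _, hp⟩⟩)
    calc _ ≤ ∑ d ∈ (Fintype.piFinset fun _ : P => B).image (tupleOfExponents P),
          (|muGlob μloc d.1| : ℝ) * ((∏ ρ, d.1 ρ : ℕ) : ℝ) ^ (-s) := by
          beta_reduce
          rw [← Finset.sum_filter_ne_zero D]
          refine Finset.sum_le_sum_of_subset_of_nonneg ?_ fun d _ _ => hnn d
          intro d hd
          rw [Finset.mem_filter] at hd
          have hne : muGlob μloc d.1 ≠ 0 := by
            intro h
            simp [h] at hd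
          rw [muGlob_eq_prod h0 (hP d hd.1), Finset.prod_ne_zero_iff] at hne
          refine Finset.mem_image.2 ⟨_, ?_, tupleOfExponents_factorization d (hP d hd.1)⟩
          exact Fintype.mem_piFinset.2 fun p => hB _ (hne p.1 p.2)
      _ = ∏ p ∈ P, E p := hT P
      _ ≤ ∏' p, E p := by
          refine ge_of_tendsto hmul.hasProd ?_
          filter_upwards [Filter.eventually_ge_atTop P] with Q hQ
          exact Finset.prod_le_prod_of_subset_of_one_le hQ
            (fun p _ => zero_le_one.trans (hE1 p)) fun p _ _ => hE1 p
  · intro b hb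
    refine le_of_tendsto' hmul.hasProd fun P => ?_
    rw [← hT P]
    exact hb ⟨_, rfl⟩

theorem multipliable_sum_abs_muLoc [DecidableEq S] (h0 : μloc 0 = 1)
    (h1 : ∀ l : S → ℕ, ∑ ρ, l ρ = 1 → μloc l = 0) (B : Finset (S → ℕ)) (hB : 0 ∈ B)
    {s : ℝ} (hs : 1 / 2 < s) :
    Multipliable fun p : Nat.Primes =>
      ∑ l ∈ B, (|μloc l| : ℝ) * ((p : ℕ) : ℝ) ^ (-(s * ((∑ ρ, l ρ : ℕ) : ℝ))) := by
  have hsummable : Summable fun p : Nat.Primes =>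
      ∑ l ∈ B.erase 0, (|μloc l| : ℝ) * ((p : ℕ) : ℝ) ^ (-(s * ((∑ ρ, l ρ : ℕ) : ℝ))) := by
    refine summable_sum fun l hl => ?_
    have hl0 : l ≠ 0 := Finset.ne_of_mem_erase hl
    by_cases hl1 : ∑ ρ, l ρ = 1
    · simp [h1 l hl1]
    refine Summable.mul_left _ (Nat.Primes.summable_rpow.2 ?_)
    have hne : ∑ ρ, l ρ ≠ 0 := by
      intro h
      refine hl0 (funext fun ρ => ?_)
      exact Finset.sum_eq_zero_iff.1 h ρ (Finset.mem_univ _)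
    have h2 : (2 : ℝ) ≤ ((∑ ρ, l ρ : ℕ) : ℝ) := by
      have : 2 ≤ ∑ ρ, l ρ := by omega
      exact_mod_cast this
    nlinarith
  refine (Real.multipliable_one_add_of_summable hsummable).congr fun p => ?_
  rw [← Finset.add_sum_erase B _ hB]
  simp [h0]

end EulerProduct

/-- For `s > 1/2`: (i) `Σ_d |μ(d)| Π(d)^{-s}` is summable over positive tuples `d`;
(ii) the product over primes of the finite sums `Σ_λ |μloc(λ)| p^{-s|λ|}` converges;
(iii) the sum equals the product. -/
theorem stmt11 (S : Type*) [Fintype S] [DecidableEq S] [Nonempty S]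
    (m : ℕ) (Λ : Fin m → S → ℕ)
    (hsum : ∀ i, 2 ≤ ∑ ρ, Λ i ρ) (hle : ∀ i ρ, Λ i ρ ≤ 2)
    (μloc : (S → ℕ) → ℤ)
    (hμ : ∀ τ : S → ℕ,
      (if ∀ i, ∃ ρ, τ ρ < Λ i ρ then (1 : ℤ) else 0) = ∑ l ∈ Finset.Iic τ, μloc l)
    (s : ℝ) (hs : 1 / 2 < s) :
    Summable (fun d : {d : S → ℕ // ∀ ρ, 0 < d ρ} =>
        (|muGlob μloc d.1| : ℝ) * ((∏ ρ, d.1 ρ : ℕ) : ℝ) ^ (-s)) ∧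
    Multipliable (fun p : Nat.Primes =>
        ∑ᶠ l : S → ℕ, (|μloc l| : ℝ) * ((p : ℕ) : ℝ) ^ (-(s * ((∑ ρ, l ρ : ℕ) : ℝ)))) ∧
    (∑' d : {d : S → ℕ // ∀ ρ, 0 < d ρ},
        (|muGlob μloc d.1| : ℝ) * ((∏ ρ, d.1 ρ : ℕ) : ℝ) ^ (-s))
      = ∏' p : Nat.Primes,
          ∑ᶠ l : S → ℕ, (|μloc l| : ℝ) * ((p : ℕ) : ℝ) ^ (-(s * ((∑ ρ, l ρ : ℕ) : ℝ))) := by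
  have h0 := muLoc_zero hsum hμ
  have hB : ∀ l, μloc l ≠ 0 → l ∈ Finset.Iic (fun _ : S => 2) := by
    intro l hl
    rw [Finset.mem_Iic]
    intro ρ
    by_contra hcon
    exact hl (muLoc_eq_zero_of_two_lt hle hμ l (not_le.1 hcon))
  have hfin : (fun p : Nat.Primes =>
      ∑ᶠ l : S → ℕ, (|μloc l| : ℝ) * ((p : ℕ) : ℝ) ^ (-(s * ((∑ ρ, l ρ : ℕ) : ℝ)))) =
      fun p : Nat.Primes => ∑ l ∈ Finset.Iic (fun _ : S => 2),
        (|μloc l| : ℝ) * ((p : ℕ) : ℝ) ^ (-(s * ((∑ ρ, l ρ : ℕ) : ℝ))) := by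
    funext p
    refine finsum_eq_sum_of_support_subset _ fun l hl => hB l ?_
    intro h
    simp [h] at hl
  have hmul := multipliable_sum_abs_muLoc h0
    (fun l hl => muLoc_eq_zero_of_sum_eq_one hsum hμ hl) _ (hB 0 (by simp [h0])) hs
  have hsumm := hasSum_abs_muGlob h0 _ hB s hmul
  rw [hfin]
  exact ⟨hsumm.summable, hmul, hsumm.tsum_eq⟩
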